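/- arXiv:2604.15698 — 2 statements merged into one kernel-verified Lean document; each statement's English description precedes it below -/
import Mathlib

section
/- Define the essential set Ess(S_O) := {s ∈ S_O : s ∉ Cn(S_O \ {s})}. Then: (i) Ess(S_O) ⊆ Atom(S_O) for every canonical order L; (ii) if Cn(Ess(S_O)) = Cn(S_O), then Atom(S_O) = Ess(S_O) for every canonical order L. -/
open scoped BigOperators Classical

noncomputable section

variable {𝕊 : Type*} [Fintype 𝕊]

/-- One step of the deletion procedure: delete `s` from the current set `A`
if `s` is derivable from the rest. -/
def atomStep (Cn : Set 𝕊 → Set 𝕊) (A : Set 𝕊) (s : 𝕊) : Set 𝕊 :=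
  if s ∈ Cn (A \ {s}) then A \ {s} else A

/-- The deletion procedure: scan the canonical list `L`, deleting redundant
elements; `Atom(S_O) = atomCore Cn S_O L`. -/
def atomCore (Cn : Set 𝕊 → Set 𝕊) (S : Set 𝕊) (L : List 𝕊) : Set 𝕊 :=
  L.foldl (atomStep Cn) S

/-- The essential set `Ess(S_O) := {s ∈ S_O : s ∉ Cn(S_O \ {s})}`. -/
def essSet (Cn : Set 𝕊 → Set 𝕊) (S : Set 𝕊) : Set 𝕊 :=
  {s ∈ S | s ∉ Cn (S \ {s})}

theorem atomStep_subset (Cn : Set 𝕊 → Set 𝕊) (A : Set 𝕊) (s : 𝕊) : atomStep Cn A s ⊆ A := by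
  unfold atomStep
  split_ifs
  · exact Set.sdiff_subset
  · exact subset_rfl

theorem atomCore_subset (Cn : Set 𝕊 → Set 𝕊) (A : Set 𝕊) (L : List 𝕊) :
    atomCore Cn A L ⊆ A := by
  induction L generalizing A with
  | nil => exact subset_rfl
  | cons s L ih => exact (ih (atomStep Cn A s)).trans (atomStep_subset Cn A s)

theorem essSet_subset_atomStep {Cn : Set 𝕊 → Set 𝕊}
    (hmono : ∀ Γ Γ' : Set 𝕊, Γ ⊆ Γ' → Cn Γ ⊆ Cn Γ') {S A : Set 𝕊}
    (hE : essSet Cn S ⊆ A) (hA : A ⊆ S) (s : 𝕊) : essSet Cn S ⊆ atomStep Cn A s := by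
  unfold atomStep
  split_ifs with hs
  · rintro x hx
    refine ⟨hE hx, ?_⟩
    rintro rfl
    exact hx.2 (hmono _ _ (Set.sdiff_subset_sdiff_left hA) hs)
  · exact hE

theorem essSet_subset_atomCore {Cn : Set 𝕊 → Set 𝕊}
    (hmono : ∀ Γ Γ' : Set 𝕊, Γ ⊆ Γ' → Cn Γ ⊆ Cn Γ') {S A : Set 𝕊}
    (hE : essSet Cn S ⊆ A) (hA : A ⊆ S) (L : List 𝕊) : essSet Cn S ⊆ atomCore Cn A L := by
  induction L generalizing A with
  | nil => exact hE
  | cons s L ih =>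
    exact ih (essSet_subset_atomStep hmono hE hA s) ((atomStep_subset Cn A s).trans hA)

/-- A scanned element derivable from the essential set survives only if it is essential. -/
theorem mem_essSet_of_mem_atomCore {Cn : Set 𝕊 → Set 𝕊}
    (hmono : ∀ Γ Γ' : Set 𝕊, Γ ⊆ Γ' → Cn Γ ⊆ Cn Γ') {S A : Set 𝕊}
    (hE : essSet Cn S ⊆ A) (hA : A ⊆ S) {L : List 𝕊} {x : 𝕊} (hxL : x ∈ L)
    (hxE : x ∈ Cn (essSet Cn S)) (hx : x ∈ atomCore Cn A L) : x ∈ essSet Cn S := by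
  induction L generalizing A with
  | nil => cases hxL
  | cons s L ih =>
    rcases List.mem_cons.1 hxL with rfl | hxL
    · by_contra hne
      have hsub : essSet Cn S ⊆ A \ {x} := Set.subset_sdiff_singleton hE hne
      have hmem : x ∈ atomStep Cn A x := atomCore_subset Cn _ L hx
      rw [atomStep, if_pos (hmono _ _ hsub hxE)] at hmem
      exact hmem.2 rfl
    · exact ih (essSet_subset_atomStep hmono hE hA s) ((atomStep_subset Cn A s).trans hA) hxL hx

/-- Order-robust core under essential generation:
(i) `Ess(S_O) ⊆ Atom(S_O)` for every canonical order `L`;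
(ii) if `Cn(Ess(S_O)) = Cn(S_O)`, then `Atom(S_O) = Ess(S_O)` for every
canonical order `L`. -/
theorem essential_order_invariance
    (Cn : Set 𝕊 → Set 𝕊)
    (hrefl : ∀ Γ : Set 𝕊, Γ ⊆ Cn Γ)
    (hmono : ∀ Γ Γ' : Set 𝕊, Γ ⊆ Γ' → Cn Γ ⊆ Cn Γ')
    (hidem : ∀ Γ : Set 𝕊, Cn (Cn Γ) = Cn Γ)
    (S_O : Set 𝕊) :
    (∀ L : List 𝕊, L.Nodup → (∀ s : 𝕊, s ∈ L ↔ s ∈ S_O) →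
        essSet Cn S_O ⊆ atomCore Cn S_O L) ∧
    (Cn (essSet Cn S_O) = Cn S_O →
      ∀ L : List 𝕊, L.Nodup → (∀ s : 𝕊, s ∈ L ↔ s ∈ S_O) →
        atomCore Cn S_O L = essSet Cn S_O) := by
  have hsub : essSet Cn S_O ⊆ S_O := fun _ hx => hx.1
  refine ⟨fun L _ _ => essSet_subset_atomCore hmono hsub subset_rfl L, fun hCn L _ hL => ?_⟩
  refine Set.Subset.antisymm (fun x hx => ?_) (essSet_subset_atomCore hmono hsub subset_rfl L)
  have hxS : x ∈ S_O := atomCore_subset Cn S_O L hx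
  exact mem_essSet_of_mem_atomCore hmono hsub subset_rfl ((hL x).2 hxS)
    (hCn ▸ hrefl S_O hxS) hx

end
end

section
/- Fix δ ≥ 0. Assume Ŝ_O is nonempty, A_δ ⊆ Ŝ_O, and that the sets R_δ(a) := {ŝ ∈ Ŝ_O : S_O ⊆ T^δ((S_O \ {a}) ∪ {ŝ})} are pairwise disjoint for distinct a ∈ A_δ. Then the infimum of I(p,W) over all test channels W from S_O to Ŝ_O achieving zero δ-step distortion for p equals P_δ·H(π_δ), with the convention that this value is 0 when P_δ = 0. -/
open scoped BigOperators Classical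

noncomputable section

variable {𝕊 : Type*} [Fintype 𝕊]

/-- Shannon entropy of a probability vector on a finite type
(natural logarithm; `Real.log 0 = 0` handles the `0·log 0 := 0` convention). -/
def entropy {X : Type*} [Fintype X] (p : X → ℝ) : ℝ :=
  -∑ x, p x * Real.log (p x)

/-- Mutual information `I(p,W) := H(p) + H(q̂) − H(q)` of a source `p` and a
channel `W`, where `q(x,y) = p(x)·W(y|x)` and `q̂` is the output marginal. -/
def mutualInfo {X Y : Type*} [Fintype X] [Fintype Y]
    (p : X → ℝ) (W : X → Y → ℝ) : ℝ :=
  entropy p + entropy (fun y => ∑ x, p x * W x y)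
    - entropy (fun z : X × Y => p z.1 * W z.1 z.2)

/-- A test channel into the alphabet `Yset`: rows are probability vectors
supported inside `Yset`. -/
def IsChannel {X Y : Type*} [Fintype Y] (W : X → Y → ℝ) (Yset : Set Y) : Prop :=
  (∀ x y, 0 ≤ W x y) ∧ (∀ x, ∑ y, W x y = 1) ∧ (∀ x y, W x y ≠ 0 → y ∈ Yset)

/-- A probability vector supported on `S`. -/
def IsProbVector {X : Type*} [Fintype X] (p : X → ℝ) (S : Set X) : Prop :=
  (∀ x, 0 ≤ p x) ∧ (∑ x, p x = 1) ∧ (∀ x, p x ≠ 0 → x ∈ S)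

/-- The probability mass `p(A)` of a set `A`. -/
def massOn {X : Type*} [Fintype X] (p : X → ℝ) (A : Set X) : ℝ :=
  ∑ x, if x ∈ A then p x else 0

/-- The conditional distribution of `p` given `A`. -/
def condOn {X : Type*} [Fintype X] (p : X → ℝ) (A : Set X) : X → ℝ :=
  fun x => if x ∈ A then p x / massOn p A else 0

/-- The δ-irredundant core `A_δ := {s ∈ S_O : s ∉ T^δ(S_O \ {s})}`. -/
def deltaCore (T : Set 𝕊 → Set 𝕊) (S : Set 𝕊) (δ : ℕ) : Set 𝕊 :=
  {s ∈ S | s ∉ T^[δ] (S \ {s})}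

/-- The channel `W` achieves zero δ-step distortion for the source `p`:
whenever `p(s) > 0` and `W(shat|s) > 0`, the whole source is recovered within
`δ` iterations of `T` after replacing `s` by `shat`. -/
def ZeroDeltaDist (T : Set 𝕊 → Set 𝕊) (S_O : Set 𝕊) (δ : ℕ)
    (p : 𝕊 → ℝ) (W : 𝕊 → 𝕊 → ℝ) : Prop :=
  ∀ s : 𝕊, 0 < p s → ∀ shat : 𝕊, 0 < W s shat →
    S_O ⊆ T^[δ] ((S_O \ {s}) ∪ {shat})

theorem massOn_nonneg {X : Type*} [Fintype X] {p : X → ℝ} (hp : ∀ x, 0 ≤ p x) (A : Set X) :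
    0 ≤ massOn p A :=
  Finset.sum_nonneg fun x _ => by split_ifs <;> simp [hp x]

theorem le_massOn {X : Type*} [Fintype X] {p : X → ℝ} (hp : ∀ x, 0 ≤ p x) {A : Set X} {x : X}
    (hx : x ∈ A) : p x ≤ massOn p A := by
  have h := Finset.single_le_sum (f := fun x => if x ∈ A then p x else 0)
    (fun x _ => by split_ifs <;> simp [hp x]) (Finset.mem_univ x)
  simpa [massOn, hx] using h

theorem massOn_add_sum_compl {X : Type*} [Fintype X] (p : X → ℝ) (A : Set X) :
    massOn p A + ∑ x, (if x ∈ A then 0 else p x) = ∑ x, p x := by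
  rw [massOn, ← Finset.sum_add_distrib]
  refine Finset.sum_congr rfl fun x _ => ?_
  by_cases hx : x ∈ A <;> simp [hx]

theorem sum_condOn {X : Type*} [Fintype X] {p : X → ℝ} {A : Set X} (hA : massOn p A ≠ 0) :
    ∑ x, condOn p A x = 1 := by
  have h : ∀ x, condOn p A x = (if x ∈ A then p x else 0) / massOn p A := fun x => by
    by_cases hx : x ∈ A <;> simp [condOn, hx]
  simp only [h, ← Finset.sum_div]
  exact div_self hA

theorem sub_le_mul_log_sub_log {a b : ℝ} (ha : 0 < a) (hb : 0 < b) :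
    a - b ≤ a * (Real.log a - Real.log b) := by
  have h := mul_le_mul_of_nonneg_left (Real.log_le_sub_one_of_pos (div_pos hb ha)) ha.le
  rw [Real.log_div hb.ne' ha.ne', mul_sub, mul_sub, mul_div_cancel₀ _ ha.ne'] at h
  linarith

/-- For a channel `W`, the gap between `I(p,W)` and `p(A)·H(p|A)`
is a single sum over source-output pairs. -/
theorem mutualInfo_sub_massOn_mul_entropy {X Y : Type*} [Fintype X] [Fintype Y]
    {p : X → ℝ} {W : X → Y → ℝ} (hp : ∀ x, 0 ≤ p x) (hW : ∀ x, ∑ y, W x y = 1) (A : Set X) :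
    mutualInfo p W - massOn p A * entropy (condOn p A) =
      ∑ x, ∑ y, p x * W x y * (Real.log (p x * W x y) - Real.log (∑ x', p x' * W x' y)
        - if x ∈ A then Real.log (massOn p A) else Real.log (p x)) := by
  have h_source : entropy p = -∑ x, ∑ y, p x * W x y * Real.log (p x) := by
    simp only [entropy, ← Finset.sum_mul, ← Finset.mul_sum, hW, mul_one]
  have h_output : entropy (fun y => ∑ x, p x * W x y) =
      -∑ x, ∑ y, p x * W x y * Real.log (∑ x', p x' * W x' y) := by
    rw [Finset.sum_comm]
    simp only [entropy, ← Finset.sum_mul]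
  have h_joint : entropy (fun z : X × Y => p z.1 * W z.1 z.2) =
      -∑ x, ∑ y, p x * W x y * Real.log (p x * W x y) := by
    simp only [entropy, Fintype.sum_prod_type]
  have h_core : massOn p A * entropy (condOn p A) =
      ∑ x, ∑ y, p x * W x y *
        if x ∈ A then Real.log (massOn p A) - Real.log (p x) else 0 := by
    simp only [entropy, ← Finset.sum_mul, ← Finset.mul_sum, hW, mul_one]
    rw [← Finset.sum_neg_distrib, Finset.mul_sum]
    refine Finset.sum_congr rfl fun x _ => ?_
    by_cases hx : x ∈ A
    · rcases (hp x).eq_or_lt with h | h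
      · simp [condOn, ← h]
      · have hP : 0 < massOn p A := h.trans_le (le_massOn hp hx)
        simp only [condOn, if_pos hx, Real.log_div h.ne' hP.ne']
        field_simp
        ring
    · simp [condOn, hx]
  rw [mutualInfo, h_source, h_output, h_joint, h_core]
  simp only [← Finset.sum_neg_distrib, ← Finset.sum_add_distrib, ← Finset.sum_sub_distrib]
  refine Finset.sum_congr rfl fun x _ => Finset.sum_congr rfl fun y _ => ?_
  split_ifs <;> ring

/-- If each output is reachable from at most one source symbol of `A`, the mutual information
is at least `p(A)·H(p|A)`. -/
theorem massOn_mul_entropy_le_mutualInfo {X Y : Type*} [Fintype X] [Fintype Y]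
    {p : X → ℝ} {W : X → Y → ℝ} (hp : ∀ x, 0 ≤ p x) (hp_sum : ∑ x, p x = 1)
    (hW_nonneg : ∀ x y, 0 ≤ W x y) (hW : ∀ x, ∑ y, W x y = 1) (A : Set X)
    (hsep : ∀ y, ∀ a₁ ∈ A, ∀ a₂ ∈ A, 0 < p a₁ * W a₁ y → 0 < p a₂ * W a₂ y → a₁ = a₂) :
    massOn p A * entropy (condOn p A) ≤ mutualInfo p W := by
  have hq : ∀ x y, 0 ≤ p x * W x y := fun x y => mul_nonneg (hp x) (hW_nonneg x y)
  set r : Y → ℝ := fun y => ∑ x, p x * W x y with hr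
  have hr_nonneg : ∀ y, 0 ≤ r y := fun y => Finset.sum_nonneg fun x _ => hq x y
  have hq_sum : ∑ x, ∑ y, p x * W x y = 1 := by simp only [← Finset.mul_sum, hW, mul_one, hp_sum]
  have hr_sum : ∑ y, r y = 1 := by rw [hr, Finset.sum_comm, hq_sum]
  let m : X → Y → ℝ := fun x y =>
    if x ∈ A then (if 0 < p x * W x y then massOn p A else 0) else p x
  have h_term : ∀ x y, p x * W x y - r y * m x y ≤ p x * W x y *
      (Real.log (p x * W x y) - Real.log (r y)
        - if x ∈ A then Real.log (massOn p A) else Real.log (p x)) := by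
    intro x y
    rcases (hq x y).eq_or_lt with h | h
    · have hm : 0 ≤ m x y := by
        simp only [m]
        split_ifs <;> first | exact massOn_nonneg hp A | exact le_rfl | exact hp x
      simpa [← h] using mul_nonneg (hr_nonneg y) hm
    · have hr_pos : 0 < r y :=
        h.trans_le (Finset.single_le_sum (f := fun x => p x * W x y)
          (fun x _ => hq x y) (Finset.mem_univ x))
      have hp_pos : 0 < p x := pos_of_mul_pos_left h (hW_nonneg x y)
      by_cases hx : x ∈ A
      · have hP : 0 < massOn p A := hp_pos.trans_le (le_massOn hp hx)
        have := sub_le_mul_log_sub_log h (mul_pos hr_pos hP)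
        rw [Real.log_mul hr_pos.ne' hP.ne', ← sub_sub] at this
        simpa only [m, if_pos hx, if_pos h] using this
      · have := sub_le_mul_log_sub_log h (mul_pos hr_pos hp_pos)
        rw [Real.log_mul hr_pos.ne' hp_pos.ne', ← sub_sub] at this
        simpa only [m, if_neg hx] using this
  have h_col : ∀ y, ∑ x, m x y ≤ 1 := by
    intro y
    have h_split : ∀ x, m x y = (if x ∈ A ∧ 0 < p x * W x y then massOn p A else 0)
        + if x ∈ A then 0 else p x := fun x => by
      by_cases hx : x ∈ A <;> simp [m, hx]
    have h_card : (Finset.univ.filter fun x => x ∈ A ∧ 0 < p x * W x y).card ≤ 1 :=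
      Finset.card_le_one.2 fun a ha b hb => by
        simp only [Finset.mem_filter, Finset.mem_univ, true_and] at ha hb
        exact hsep y a ha.1 b hb.1 ha.2 hb.2
    have h_core : ∑ x, (if x ∈ A ∧ 0 < p x * W x y then massOn p A else 0) ≤ massOn p A := by
      rw [← Finset.sum_filter, Finset.sum_const, nsmul_eq_mul]
      exact mul_le_of_le_one_left (massOn_nonneg hp A) (by exact_mod_cast h_card)
    simp only [h_split, Finset.sum_add_distrib]
    rw [← hp_sum, ← massOn_add_sum_compl p A]
    exact add_le_add h_core le_rfl
  have h_total : ∑ x, ∑ y, r y * m x y ≤ 1 := by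
    rw [Finset.sum_comm, ← hr_sum]
    refine Finset.sum_le_sum fun y _ => ?_
    rw [← Finset.mul_sum]
    exact mul_le_of_le_one_right (hr_nonneg y) (h_col y)
  have h_gap := Finset.sum_le_sum fun x (_ : x ∈ Finset.univ) =>
    Finset.sum_le_sum fun y (_ : y ∈ Finset.univ) => h_term x y
  rw [← mutualInfo_sub_massOn_mul_entropy hp hW A] at h_gap
  simp only [Finset.sum_sub_distrib, hq_sum] at h_gap
  linarith

/-- The channel that transmits `A` noiselessly and resamples everything else from `p` given `A`
has mutual information `p(A)·H(p|A)`. -/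
theorem mutualInfo_resample {X : Type*} [Fintype X] {p : X → ℝ} (hp : ∀ x, 0 ≤ p x)
    (hp_sum : ∑ x, p x = 1) {A : Set X} (hA : massOn p A ≠ 0) :
    mutualInfo p (fun x y => if x ∈ A then (if y = x then 1 else 0) else condOn p A y) =
      massOn p A * entropy (condOn p A) := by
  have h_row : ∀ x : X,
      ∑ y, (if x ∈ A then (if y = x then 1 else 0) else condOn p A y : ℝ) = 1 := fun x => by
    by_cases hx : x ∈ A
    · simp [hx]
    · simpa [hx] using sum_condOn hA
  have h_output : ∀ y, ∑ x, p x *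
      (if x ∈ A then (if y = x then 1 else 0) else condOn p A y) = condOn p A y := fun y => by
    have h_split : ∀ x, p x * (if x ∈ A then (if y = x then 1 else 0) else condOn p A y) =
        (if y = x then (if x ∈ A then p x else 0) else 0)
          + (if x ∈ A then 0 else p x) * condOn p A y := fun x => by
      by_cases hx : x ∈ A <;> simp [hx]
    simp only [h_split, Finset.sum_add_distrib, ← Finset.sum_mul, Finset.sum_ite_eq,
      Finset.mem_univ, if_true]
    have h_compl : ∑ x, (if x ∈ A then 0 else p x) = 1 - massOn p A := by
      rw [← hp_sum, ← massOn_add_sum_compl p A]; ring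
    rw [h_compl]
    by_cases hy : y ∈ A
    · simp only [condOn, hy, if_true]
      field_simp
      ring
    · simp [condOn, hy]
  rw [← sub_eq_zero, mutualInfo_sub_massOn_mul_entropy hp h_row A]
  refine Finset.sum_eq_zero fun x _ => Finset.sum_eq_zero fun y _ => ?_
  rw [h_output]
  by_cases hpx : p x = 0
  · simp [hpx]
  by_cases hx : x ∈ A
  · by_cases hy : y = x
    · subst hy
      simp [condOn, hx, Real.log_div hpx hA]
    · simp [hx, hy]
  · by_cases hy : condOn p A y = 0
    · simp [hx, hy]
    · simp [hx, Real.log_mul hpx hy]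

/-- A channel with constant output carries no information. -/
theorem mutualInfo_const {X Y : Type*} [Fintype X] [Fintype Y] {p : X → ℝ}
    (hp_sum : ∑ x, p x = 1) (y₀ : Y) :
    mutualInfo p (fun _ y => if y = y₀ then 1 else 0) = 0 := by
  simp [mutualInfo, entropy, Fintype.sum_prod_type, hp_sum]

theorem subset_iterate_of_inflationary {X : Type*} {T : Set X → Set X}
    (hinfl : ∀ B : Set X, B ⊆ T B) (n : ℕ) (B : Set X) : B ⊆ T^[n] B :=
  Function.id_le_iterate_of_id_le hinfl n B

theorem subset_iterate_of_notMem_deltaCore {X : Type*} {T : Set X → Set X}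
    (hinfl : ∀ B : Set X, B ⊆ T B) (hmono : ∀ B B' : Set X, B ⊆ B' → T B ⊆ T B')
    {S : Set X} {δ : ℕ} {s : X} (hs : s ∈ S)
    (hs_core : s ∉ deltaCore T S δ) (t : X) : S ⊆ T^[δ] ((S \ {s}) ∪ {t}) := by
  have h_derivable : s ∈ T^[δ] (S \ {s}) := by
    by_contra h
    exact hs_core ⟨hs, h⟩
  have hT : Monotone T := fun B B' => hmono B B'
  intro u hu
  by_cases hus : u = s
  · rw [hus]
    exact hT.iterate δ Set.subset_union_left h_derivable
  · exact subset_iterate_of_inflationary hinfl δ _ (Or.inl ⟨hu, hus⟩)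

/-- Exact zero-distortion rate–depth tradeoff: if
`A_δ ⊆ Shat_O` and the δ-step zero-distortion sets `R_δ(a)` of distinct
elements of `A_δ` are pairwise disjoint, then the infimum of `I(p,W)` over
zero-δ-step-distortion test channels equals `P_δ·H(π_δ)` (which is `0` when
`P_δ = 0`, automatically since then `π_δ ≡ 0`). -/
theorem rate_depth_zero_distortion
    (T : Set 𝕊 → Set 𝕊)
    (hinfl : ∀ B : Set 𝕊, B ⊆ T B)
    (hmono : ∀ B B' : Set 𝕊, B ⊆ B' → T B ⊆ T B')
    (S_O Shat_O : Set 𝕊) (δ : ℕ)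
    (p : 𝕊 → ℝ) (hp : IsProbVector p S_O)
    (hShatne : Shat_O.Nonempty)
    (hAsub : deltaCore T S_O δ ⊆ Shat_O)
    (hdisj : ∀ a₁ ∈ deltaCore T S_O δ, ∀ a₂ ∈ deltaCore T S_O δ, a₁ ≠ a₂ →
      {shat ∈ Shat_O | S_O ⊆ T^[δ] ((S_O \ {a₁}) ∪ {shat})} ∩
        {shat ∈ Shat_O | S_O ⊆ T^[δ] ((S_O \ {a₂}) ∪ {shat})} = ∅) :
    sInf {r : EReal | ∃ W : 𝕊 → 𝕊 → ℝ, IsChannel W Shat_O ∧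
        ZeroDeltaDist T S_O δ p W ∧ r = ((mutualInfo p W : ℝ) : EReal)} =
      ((massOn p (deltaCore T S_O δ) *
          entropy (condOn p (deltaCore T S_O δ)) : ℝ) : EReal) := by
  obtain ⟨hp_nonneg, hp_sum, hp_supp⟩ := hp
  set A := deltaCore T S_O δ with hA
  have h_free : ∀ s, 0 < p s → s ∉ A → ∀ t, S_O ⊆ T^[δ] ((S_O \ {s}) ∪ {t}) :=
    fun s hs hsA t => subset_iterate_of_notMem_deltaCore hinfl hmono (hp_supp s hs.ne') hsA t
  refine le_antisymm (sInf_le ?_) (le_sInf ?_)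
  · by_cases hP : massOn p A = 0
    · obtain ⟨y₀, hy₀⟩ := hShatne
      refine ⟨fun _ y => if y = y₀ then 1 else 0, ⟨fun x y => ?_, fun x => ?_, fun x y hy => ?_⟩,
        fun s hs t _ => ?_, ?_⟩
      · dsimp only
        split_ifs <;> norm_num
      · simp
      · have : y = y₀ := by simpa using hy
        exact this ▸ hy₀
      · refine h_free s hs (fun hsA => ?_) t
        exact (hs.trans_le (le_massOn hp_nonneg hsA)).ne' hP
      · rw [mutualInfo_const hp_sum, hP, zero_mul]
    · refine ⟨fun x y => if x ∈ A then (if y = x then 1 else 0) else condOn p A y,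
        ⟨fun x y => ?_, fun x => ?_, fun x y hy => ?_⟩, fun s hs t ht => ?_, ?_⟩
      · have h_cond : 0 ≤ condOn p A y := by
          unfold condOn
          split_ifs
          · exact div_nonneg (hp_nonneg y) (massOn_nonneg hp_nonneg A)
          · exact le_rfl
        dsimp only
        split_ifs <;> first | exact h_cond | norm_num
      · by_cases hx : x ∈ A
        · simp [hx]
        · simpa [hx] using sum_condOn hP
      · apply hAsub
        by_contra hyA
        by_cases hx : x ∈ A
        · have : y = x := by simpa [hx] using hy
          exact hyA (this ▸ hx)
        · exact hy (by simp [hx, condOn, hyA])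
      · by_cases hsA : s ∈ A
        · have hts : t = s := by
            by_contra h
            simp [hsA, h] at ht
          refine Set.Subset.trans ?_ (subset_iterate_of_inflationary hinfl δ _)
          rw [hts, Set.sdiff_union_self]
          exact Set.subset_union_left
        · exact h_free s hs hsA t
      · rw [mutualInfo_resample hp_nonneg hp_sum hP]
  · rintro _ ⟨W, ⟨hW_nonneg, hW_sum, hW_supp⟩, hW_zero, rfl⟩
    refine EReal.coe_le_coe_iff.2
      (massOn_mul_entropy_le_mutualInfo hp_nonneg hp_sum hW_nonneg hW_sum A ?_)
    intro y a₁ ha₁ a₂ ha₂ h₁ h₂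
    have h_mem : ∀ a, 0 < p a * W a y →
        y ∈ {shat ∈ Shat_O | S_O ⊆ T^[δ] ((S_O \ {a}) ∪ {shat})} := fun a h => by
      have hWa : 0 < W a y := pos_of_mul_pos_right h (hp_nonneg a)
      exact ⟨hW_supp a y hWa.ne', hW_zero a (pos_of_mul_pos_left h (hW_nonneg a y)) y hWa⟩
    by_contra hne
    exact Set.eq_empty_iff_forall_notMem.1 (hdisj a₁ ha₁ a₂ ha₂ hne) y ⟨h_mem a₁ h₁, h_mem a₂ h₂⟩

end
end
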